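/- Let β ∈ R_h^+ and assume the Euclidean length L_g(β) is finite and positive. Define ℓ_g : [0,1] → [0,1] by ℓ_g(t) = L_g(β)^{−1} ∫₀^t |β'(u)|_g du. Then there exists a curve α ∈ R_g such that α(ℓ_g(t)) = β(t) for all t ∈ [0,1], |α'(t)|_g = L_g(α) for almost every t ∈ [0,1], and λ_{1,p}(α) ≥ λ_{1,p}(β) for all p ≥ 2. -/

import Mathlib

open Set MeasureTheory Filter Topology

noncomputable section

/-- The closed quarter plane `P`. -/
def Pset : Set (ℝ × ℝ) := {z | 0 ≤ z.1 ∧ 0 ≤ z.2}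

/-- The interior `P°` of the quarter plane. -/
def Pint : Set (ℝ × ℝ) := {z | 0 < z.1 ∧ 0 < z.2}

/-- The boundary `∂P` of the quarter plane. -/
def Pbdry : Set (ℝ × ℝ) := {z | (0 ≤ z.1 ∧ 0 ≤ z.2) ∧ (z.1 = 0 ∨ z.2 = 0)}

/-- `F(x,y) = c_n x^(n-1) y^(n-1)`. -/
def Fvol (n : ℕ) (cn : ℝ) (z : ℝ × ℝ) : ℝ := cn * z.1 ^ (n - 1) * z.2 ^ (n - 1)

/-- Euclidean speed of a curve at `t`, computed with derivatives within `s`. -/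
def gSpeedOn (s : Set ℝ) (α : ℝ → ℝ × ℝ) (t : ℝ) : ℝ :=
  Real.sqrt ((derivWithin (fun u => (α u).1) s t) ^ 2 + (derivWithin (fun u => (α u).2) s t) ^ 2)

/-- Euclidean speed of a curve defined on `[0,1]`. -/
def gSpeed (α : ℝ → ℝ × ℝ) : ℝ → ℝ := gSpeedOn (Icc 0 1) α

/-- Euclidean length `L_g` of a curve on `[0,1]`. -/
def Lg (α : ℝ → ℝ × ℝ) : ℝ := ∫ t in (0:ℝ)..1, gSpeed α t

/-- The `h`-speed `|γ'|_h = F(γ) |γ'|_g`, with derivatives within `s`. -/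
def hSpeedOn (n : ℕ) (cn : ℝ) (s : Set ℝ) (α : ℝ → ℝ × ℝ) (t : ℝ) : ℝ :=
  Fvol n cn (α t) * gSpeedOn s α t

/-- The `h`-speed for curves defined on `[0,1)`. -/
def hSpeed (n : ℕ) (cn : ℝ) (α : ℝ → ℝ × ℝ) : ℝ → ℝ := hSpeedOn n cn (Ico 0 1) α

/-- The `h`-length `L_h` of a curve on `[0,1)`. -/
def Lh (n : ℕ) (cn : ℝ) (α : ℝ → ℝ × ℝ) : ℝ := ∫ t in (0:ℝ)..1, hSpeed n cn α t

/-- Numerator integrand of the `g`-Rayleigh quotient: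
`|w'(t)|^p F(α t) |α'(t)|_g^(1-p)`. -/
def numG (n : ℕ) (cn p : ℝ) (s : Set ℝ) (α : ℝ → ℝ × ℝ) (w : ℝ → ℝ) (t : ℝ) : ℝ :=
  |derivWithin w (Icc 0 1) t| ^ p * Fvol n cn (α t) * gSpeedOn s α t ^ (1 - p)

/-- Denominator integrand of the `g`-Rayleigh quotient:
`|w(t)|^p F(α t) |α'(t)|_g`. -/
def denG (n : ℕ) (cn p : ℝ) (s : Set ℝ) (α : ℝ → ℝ × ℝ) (w : ℝ → ℝ) (t : ℝ) : ℝ :=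
  |w t| ^ p * Fvol n cn (α t) * gSpeedOn s α t

/-- First Dirichlet eigenvalue of the `p`-Laplacian along a curve, `g`-form:
infimum of the Rayleigh quotient over Lipschitz test functions on `[0,1]`
vanishing at `0` (with admissible, i.e. integrable with positive denominator,
Rayleigh quotients). -/
def lambdaGOn (n : ℕ) (cn p : ℝ) (s : Set ℝ) (α : ℝ → ℝ × ℝ) : ℝ :=
  sInf {q | ∃ w : ℝ → ℝ, (∃ K, LipschitzOnWith K w (Icc 0 1)) ∧ w 0 = 0 ∧
    IntervalIntegrable (numG n cn p s α w) volume 0 1 ∧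
    IntervalIntegrable (denG n cn p s α w) volume 0 1 ∧
    (0 < ∫ t in (0:ℝ)..1, denG n cn p s α w t) ∧
    q = (∫ t in (0:ℝ)..1, numG n cn p s α w t) / (∫ t in (0:ℝ)..1, denG n cn p s α w t)}

/-- `λ_{1,p}` in the `g`-form for curves on `[0,1]`. -/
def lambdaG (n : ℕ) (cn p : ℝ) (α : ℝ → ℝ × ℝ) : ℝ := lambdaGOn n cn p (Icc 0 1) α

/-- Numerator integrand of the `h`-Rayleigh quotient on `[c,d]`:
`|w'(t)|^p F(γ t)^p |γ'(t)|_h^(1-p)`. -/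
def numH (n : ℕ) (cn p c d : ℝ) (s : Set ℝ) (γ : ℝ → ℝ × ℝ) (w : ℝ → ℝ) (t : ℝ) : ℝ :=
  |derivWithin w (Icc c d) t| ^ p * Fvol n cn (γ t) ^ p * hSpeedOn n cn s γ t ^ (1 - p)

/-- Denominator integrand of the `h`-Rayleigh quotient: `|w(t)|^p |γ'(t)|_h`. -/
def denH (n : ℕ) (cn p : ℝ) (s : Set ℝ) (γ : ℝ → ℝ × ℝ) (w : ℝ → ℝ) (t : ℝ) : ℝ :=
  |w t| ^ p * hSpeedOn n cn s γ t

/-- `λ_{1,p}` in the `h`-form for a curve on `[c,d)`, with test functions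
Lipschitz on `[c,d]` vanishing at `c`. -/
def lambdaHOn (n : ℕ) (cn p c d : ℝ) (s : Set ℝ) (γ : ℝ → ℝ × ℝ) : ℝ :=
  sInf {q | ∃ w : ℝ → ℝ, (∃ K, LipschitzOnWith K w (Icc c d)) ∧ w c = 0 ∧
    IntervalIntegrable (numH n cn p c d s γ w) volume c d ∧
    IntervalIntegrable (denH n cn p s γ w) volume c d ∧
    (0 < ∫ t in c..d, denH n cn p s γ w t) ∧
    q = (∫ t in c..d, numH n cn p c d s γ w t) / (∫ t in c..d, denH n cn p s γ w t)}

/-- `λ_{1,p}` in the `h`-form for curves on `[0,1)`. -/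
def lambdaH (n : ℕ) (cn p : ℝ) (γ : ℝ → ℝ × ℝ) : ℝ :=
  lambdaHOn n cn p 0 1 (Ico 0 1) γ

/-- The class `𝒞` of `C¹` curves from `(x₀,y₀)` to the boundary, with constant
speed, interior image on `[0,1)`, endpoint away from the origin, and meeting the
boundary orthogonally. -/
def MemC (x0 y0 : ℝ) (α : ℝ → ℝ × ℝ) : Prop :=
  ContDiffOn ℝ 1 α (Icc 0 1) ∧
  α 0 = (x0, y0) ∧
  (∀ t ∈ Ico (0:ℝ) 1, α t ∈ Pint) ∧
  α 1 ∈ Pbdry ∧ α 1 ≠ ((0 : ℝ), (0 : ℝ)) ∧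
  (∀ t ∈ Icc (0:ℝ) 1, gSpeed α t = Lg α) ∧
  ((α 1).1 = 0 → derivWithin (fun u => (α u).2) (Icc 0 1) 1 = 0) ∧
  ((α 1).2 = 0 → derivWithin (fun u => (α u).1) (Icc 0 1) 1 = 0)

/-- The Simons cone curve `σ(t) = (1-t)·(R,R)`. -/
def simonsCurve (R : ℝ) : ℝ → ℝ × ℝ := fun t => ((1 - t) * R, (1 - t) * R)

/-- The class `R_h`: locally Lipschitz curves on `[0,1)` with image in `P°`,
starting at `(x₀,y₀)`, with essentially bounded `h`-speed, reaching the collapsed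
boundary point as `t → 1` (i.e. `x(γ t)·y(γ t) → 0`). -/
def MemRh (n : ℕ) (cn x0 y0 : ℝ) (γ : ℝ → ℝ × ℝ) : Prop :=
  γ 0 = (x0, y0) ∧
  (∀ t ∈ Ico (0:ℝ) 1, γ t ∈ Pint) ∧
  (∀ a ∈ Ico (0:ℝ) 1, ∃ K, LipschitzOnWith K γ (Icc 0 a)) ∧
  (∃ M : ℝ, ∀ᵐ t ∂(volume : Measure ℝ), t ∈ Ico (0:ℝ) 1 → hSpeed n cn γ t ≤ M) ∧
  Tendsto (fun t => (γ t).1 * (γ t).2) (𝓝[<] (1:ℝ)) (𝓝 0)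

/-- The class `R_h^+`: continuous curves on `[0,1]` into `P` ending on `∂P`
whose restriction to `[0,1)` belongs to `R_h`. -/
def MemRhPlus (n : ℕ) (cn x0 y0 : ℝ) (α : ℝ → ℝ × ℝ) : Prop :=
  ContinuousOn α (Icc 0 1) ∧ (∀ t ∈ Icc (0:ℝ) 1, α t ∈ Pset) ∧ α 1 ∈ Pbdry ∧
  MemRh n cn x0 y0 α

/-- The class `R_g`: Lipschitz curves on `[0,1]` from `(x₀,y₀)` to `∂P` with
interior image on `[0,1)`. -/
def MemRg (x0 y0 : ℝ) (α : ℝ → ℝ × ℝ) : Prop :=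
  (∃ K, LipschitzOnWith K α (Icc 0 1)) ∧ α 0 = (x0, y0) ∧ α 1 ∈ Pbdry ∧
  ∀ t ∈ Ico (0:ℝ) 1, α t ∈ Pint

/-- The coordinate `u(x,y) = (x² - y²)/2`. -/
def ucoord (z : ℝ × ℝ) : ℝ := (z.1 ^ 2 - z.2 ^ 2) / 2

/-- The coordinate `v(x,y) = xy`. -/
def vcoord (z : ℝ × ℝ) : ℝ := z.1 * z.2

/-- The coordinate `r = √(u² + v²)`. -/
def rcoord (z : ℝ × ℝ) : ℝ := Real.sqrt (ucoord z ^ 2 + vcoord z ^ 2)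

/-- The class `R_g^*`: simple curves in `R_g` with a.e. constant speed,
`u(α(1)) > 0`, and `v(α(t)) ≥ c(1-t)` for some `c > 0`. -/
def MemRgStar (x0 y0 : ℝ) (α : ℝ → ℝ × ℝ) : Prop :=
  MemRg x0 y0 α ∧ InjOn α (Icc 0 1) ∧
  (∀ᵐ t ∂(volume : Measure ℝ), t ∈ Icc (0:ℝ) 1 → gSpeed α t = Lg α) ∧
  0 < ucoord (α 1) ∧
  ∃ c > (0:ℝ), ∀ t ∈ Icc (0:ℝ) 1, c * (1 - t) ≤ vcoord (α t)
/-- The distribution function of a density on the unit interval. -/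
def cumul (ρ : ℝ → ℝ) (t : ℝ) : ℝ := ∫ u in (0:ℝ)..t, ρ u

/-- A nonnegative integrable density of total mass `1` carried by `(0,1]`. -/
structure UnitDensity (ρ : ℝ → ℝ) : Prop where
  integrable : Integrable ρ
  nonneg : ∀ t, 0 ≤ ρ t
  eq_zero : ∀ t ∉ Ioc (0:ℝ) 1, ρ t = 0
  total : ∫ t in (0:ℝ)..1, ρ t = 1

namespace UnitDensity

variable {ρ : ℝ → ℝ}

theorem cumul_sub (h : UnitDensity ρ) (a b : ℝ) :
    cumul ρ b - cumul ρ a = ∫ u in a..b, ρ u :=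
  intervalIntegral.integral_interval_sub_left h.integrable.intervalIntegrable
    h.integrable.intervalIntegrable

theorem cumul_monotone (h : UnitDensity ρ) : Monotone (cumul ρ) := fun a b hab => by
  have := h.cumul_sub a b
  have := intervalIntegral.integral_nonneg (μ := volume) hab (fun u _ => h.nonneg u)
  linarith

theorem cumul_continuous (h : UnitDensity ρ) : Continuous (cumul ρ) :=
  intervalIntegral.continuous_primitive (fun _ _ => h.integrable.intervalIntegrable) 0

theorem cumul_zero : cumul ρ 0 = 0 := by simp [cumul]

theorem cumul_one (h : UnitDensity ρ) : cumul ρ 1 = 1 := h.total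

theorem setIntegral_Iic (h : UnitDensity ρ) (t : ℝ) : ∫ u in Iic t, ρ u = cumul ρ t := by
  have h1 := intervalIntegral.integral_Iic_sub_Iic (μ := volume) (f := ρ) (a := 0) (b := t)
    h.integrable.integrableOn h.integrable.integrableOn
  have h2 : ∫ u in Iic (0:ℝ), ρ u = 0 :=
    setIntegral_eq_zero_of_forall_eq_zero fun u hu => h.eq_zero u fun hu' => hu'.1.not_ge hu
  rw [h2, sub_zero] at h1
  exact h1

theorem cumul_nonneg (h : UnitDensity ρ) (t : ℝ) : 0 ≤ cumul ρ t := by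
  rw [← h.setIntegral_Iic]
  exact integral_nonneg h.nonneg

theorem cumul_le_one (h : UnitDensity ρ) (t : ℝ) : cumul ρ t ≤ 1 := by
  rcases le_total t 1 with ht | ht
  · exact h.cumul_one ▸ h.cumul_monotone ht
  · have h1 := h.cumul_sub 1 t
    have h2 : ∫ u in (1:ℝ)..t, ρ u = 0 := by
      rw [intervalIntegral.integral_of_le ht]
      exact setIntegral_eq_zero_of_forall_eq_zero fun u hu =>
        h.eq_zero u fun hu' => hu.1.not_ge hu'.2
    linarith [h.cumul_one]

theorem cumul_mem (h : UnitDensity ρ) (t : ℝ) : cumul ρ t ∈ Icc (0:ℝ) 1 :=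
  ⟨h.cumul_nonneg t, h.cumul_le_one t⟩

theorem exists_cumul_eq (h : UnitDensity ρ) {s : ℝ} (hs : s ∈ Icc (0:ℝ) 1) :
    ∃ t ∈ Icc (0:ℝ) 1, cumul ρ t = s := by
  have := intermediate_value_Icc zero_le_one h.cumul_continuous.continuousOn
  rw [cumul_zero, h.cumul_one] at this
  exact this hs

/-- The measure with density `ρ`. -/
def measure (ρ : ℝ → ℝ) : Measure ℝ := volume.withDensity fun t => ENNReal.ofReal (ρ t)

theorem isFiniteMeasure (h : UnitDensity ρ) : IsFiniteMeasure (measure ρ) :=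
  isFiniteMeasure_withDensity_ofReal h.integrable.2

theorem measure_Iic (h : UnitDensity ρ) (t : ℝ) :
    measure ρ (Iic t) = ENNReal.ofReal (cumul ρ t) := by
  rw [measure, withDensity_apply _ measurableSet_Iic, ← h.setIntegral_Iic,
    ofReal_integral_eq_lintegral_ofReal h.integrable.integrableOn (ae_of_all _ h.nonneg)]

theorem exists_preimage_Iic (h : UnitDensity ρ) {c : ℝ} (h0 : 0 ≤ c) (h1 : c < 1) :
    ∃ T, cumul ρ T = c ∧ cumul ρ ⁻¹' Iic c = Iic T := by
  set A : Set ℝ := cumul ρ ⁻¹' Iic c with hA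
  have hbdd : BddAbove A := ⟨1, fun t ht => by
    by_contra! hlt
    have := h.cumul_monotone hlt.le
    rw [h.cumul_one] at this
    exact absurd (this.trans ht) (by simpa using h1)⟩
  have hne : A.Nonempty := ⟨0, by simpa [hA, cumul_zero] using h0⟩
  have hclosed : IsClosed A := isClosed_Iic.preimage h.cumul_continuous
  have hmem : sSup A ∈ A := hclosed.csSup_mem hne hbdd
  have hA_eq : A = Iic (sSup A) := by
    ext t
    exact ⟨fun ht => le_csSup hbdd ht, fun ht => (h.cumul_monotone ht).trans hmem⟩
  refine ⟨sSup A, le_antisymm hmem ?_, hA_eq⟩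
  have hle : sSup A ≤ 1 := by
    by_contra! hlt
    have : (1:ℝ) ∈ A := by rw [hA_eq]; exact hlt.le
    have : cumul ρ 1 ≤ c := this
    rw [h.cumul_one] at this
    linarith
  have hiv := intermediate_value_Icc hle h.cumul_continuous.continuousOn
  obtain ⟨T, hT, hTc⟩ := hiv ⟨hmem, by rw [h.cumul_one]; exact h1.le⟩
  have : T ≤ sSup A := le_csSup hbdd (by simp [hA, hTc])
  rw [← hTc]
  exact h.cumul_monotone this

theorem map_cumul (h : UnitDensity ρ) :
    (measure ρ).map (cumul ρ) = volume.restrict (Icc (0:ℝ) 1) := by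
  have := h.isFiniteMeasure
  refine Measure.ext_of_Iic _ _ fun c => ?_
  rw [Measure.map_apply h.cumul_continuous.measurable measurableSet_Iic,
    Measure.restrict_apply measurableSet_Iic]
  rcases lt_or_ge c 0 with hc | hc
  · have e1 : cumul ρ ⁻¹' Iic c = ∅ := by
      ext t
      simpa using hc.trans_le (h.cumul_nonneg t)
    have e2 : Iic c ∩ Icc (0:ℝ) 1 = ∅ := by
      ext t
      simp only [mem_inter_iff, mem_Iic, mem_Icc, mem_empty_iff_false, iff_false]
      rintro ⟨h1, h2, -⟩
      linarith
    rw [e1, e2, measure_empty, measure_empty]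
  rcases lt_or_ge c 1 with hc1 | hc1
  · obtain ⟨T, hT, hpre⟩ := h.exists_preimage_Iic hc hc1
    have e2 : Iic c ∩ Icc (0:ℝ) 1 = Icc 0 c := by
      ext t
      simp only [mem_inter_iff, mem_Iic, mem_Icc]
      exact ⟨fun h => ⟨h.2.1, h.1⟩, fun h => ⟨h.2, h.1, h.2.trans hc1.le⟩⟩
    rw [hpre, h.measure_Iic, hT, e2, Real.volume_Icc, sub_zero]
  · have e1 : cumul ρ ⁻¹' Iic c = univ :=
      eq_univ_of_forall fun t => (h.cumul_le_one t).trans hc1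
    have e2 : Iic c ∩ Icc (0:ℝ) 1 = Icc 0 1 :=
      inter_eq_right.2 fun t ht => ht.2.trans hc1
    have e3 : ∫ t, ρ t = 1 := by
      rw [← h.total, intervalIntegral.integral_of_le zero_le_one]
      exact (setIntegral_eq_integral_of_forall_compl_eq_zero fun t ht => h.eq_zero t ht).symm
    rw [e1, e2, measure, withDensity_apply _ MeasurableSet.univ, Measure.restrict_univ,
      ← ofReal_integral_eq_lintegral_ofReal h.integrable (ae_of_all _ h.nonneg), e3]
    simp

theorem aemeasurable_ofReal (h : UnitDensity ρ) :
    AEMeasurable fun t => ENNReal.ofReal (ρ t) :=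
  h.integrable.aestronglyMeasurable.aemeasurable.ennreal_ofReal

theorem ae_measure_iff (h : UnitDensity ρ) {p : ℝ → Prop} :
    (∀ᵐ t ∂measure ρ, p t) ↔ ∀ᵐ t, ρ t ≠ 0 → p t := by
  rw [measure, ae_withDensity_iff' h.aemeasurable_ofReal]
  refine eventually_congr (Eventually.of_forall fun t => ?_)
  have : ENNReal.ofReal (ρ t) ≠ 0 ↔ ρ t ≠ 0 := by
    rw [Ne, ENNReal.ofReal_eq_zero, not_le]
    exact ⟨fun h => h.ne', fun h' => (h.nonneg t).lt_of_ne' h'⟩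
  rw [this]

theorem ae_comp_cumul (h : UnitDensity ρ) {p : ℝ → Prop}
    (hp : ∀ᵐ s, s ∈ Icc (0:ℝ) 1 → p s) : ∀ᵐ t, ρ t ≠ 0 → p (cumul ρ t) := by
  rw [← h.ae_measure_iff]
  refine ae_of_ae_map h.cumul_continuous.aemeasurable ?_
  rw [h.map_cumul]
  exact (ae_restrict_iff' measurableSet_Icc).2 hp

theorem ae_of_ae_comp_cumul (h : UnitDensity ρ) {p : ℝ → Prop} (hm : MeasurableSet {s | p s})
    (hp : ∀ᵐ t, ρ t ≠ 0 → p (cumul ρ t)) : ∀ᵐ s, s ∈ Icc (0:ℝ) 1 → p s := by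
  rw [← ae_restrict_iff' measurableSet_Icc, ← h.map_cumul,
    ae_map_iff h.cumul_continuous.aemeasurable hm]
  exact h.ae_measure_iff.2 hp

theorem ae_hasDerivAt_cumul (h : UnitDensity ρ) : ∀ᵐ t, HasDerivAt (cumul ρ) (ρ t) t := by
  filter_upwards [LocallyIntegrable.ae_hasDerivAt_integral h.integrable.locallyIntegrable] with t ht
  exact ht 0

theorem integrable_comp_cumul (h : UnitDensity ρ) {f : ℝ → ℝ}
    (hf : IntervalIntegrable f volume 0 1) : Integrable fun t => ρ t * f (cumul ρ t) := by
  rw [intervalIntegrable_iff_integrableOn_Icc_of_le zero_le_one, IntegrableOn, ← h.map_cumul] at hf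
  have := hf.comp_measurable h.cumul_continuous.measurable
  rw [measure, integrable_withDensity_iff_integrable_smul₀' h.aemeasurable_ofReal (by simp)] at this
  simpa [ENNReal.toReal_ofReal (h.nonneg _)] using this

theorem integral_comp_cumul (h : UnitDensity ρ) {f : ℝ → ℝ}
    (hf : IntervalIntegrable f volume 0 1) :
    ∫ t in (0:ℝ)..1, ρ t * f (cumul ρ t) = ∫ s in (0:ℝ)..1, f s := by
  rw [intervalIntegrable_iff_integrableOn_Icc_of_le zero_le_one, IntegrableOn, ← h.map_cumul] at hf
  rw [intervalIntegral.integral_of_le zero_le_one (f := f), ← integral_Icc_eq_integral_Ioc,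
    ← h.map_cumul, integral_map h.cumul_continuous.aemeasurable hf.aestronglyMeasurable,
    measure, integral_withDensity_eq_integral_toReal_smul₀ h.aemeasurable_ofReal (by simp),
    intervalIntegral.integral_of_le zero_le_one]
  simp only [ENNReal.toReal_ofReal (h.nonneg _), smul_eq_mul]
  exact setIntegral_eq_integral_of_forall_compl_eq_zero fun t ht => by simp [h.eq_zero t ht]

end UnitDensity

theorem abs_sub_le_integral_of_locally_lipschitz {f φ : ℝ → ℝ} (hc : ContinuousOn f (Icc 0 1))
    (hlip : ∀ a ∈ Ico (0:ℝ) 1, ∃ K, LipschitzOnWith K f (Icc 0 a)) (hφ : Integrable φ)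
    (hle : ∀ t ∈ Ioo (0:ℝ) 1, |deriv f t| ≤ φ t) {a b : ℝ} (ha : 0 ≤ a) (hab : a ≤ b)
    (hb : b ≤ 1) : |f b - f a| ≤ ∫ t in a..b, φ t := by
  rcases hab.eq_or_lt with rfl | hab
  · simp
  have key : ∀ c ∈ Ico a 1, |f c - f a| ≤ ∫ t in a..c, φ t := by
    intro c hca
    obtain ⟨K, hK⟩ := hlip c ⟨ha.trans hca.1, hca.2⟩
    have hac : AbsolutelyContinuousOnInterval f a c :=
      (hK.mono (by rw [uIcc_of_le hca.1]; exact Icc_subset_Icc_left ha)).absolutelyContinuousOnInterval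
    rw [← hac.integral_deriv_eq_sub]
    refine (intervalIntegral.abs_integral_le_integral_abs hca.1).trans ?_
    refine intervalIntegral.integral_mono_on_of_le_Ioo hca.1 hac.intervalIntegrable_deriv.abs
      hφ.intervalIntegrable fun t ht => hle t ⟨ha.trans_lt ht.1, ht.2.trans hca.2⟩
  have hcl : b ∈ closure (Ico a 1) := by
    rw [closure_Ico (hab.trans_le hb).ne]
    exact ⟨hab.le, hb⟩
  refine ContinuousWithinAt.closure_le hcl ?_ ?_ key
  · exact ((((hc b ⟨ha.trans hab.le, hb⟩).mono fun t ht => ⟨ha.trans ht.1, ht.2.le⟩)).sub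
      continuousWithinAt_const).abs
  · exact (intervalIntegral.continuous_primitive
      (fun _ _ => hφ.intervalIntegrable) a).continuousWithinAt

theorem gSpeedOn_nonneg (s : Set ℝ) (α : ℝ → ℝ × ℝ) (t : ℝ) : 0 ≤ gSpeedOn s α t :=
  Real.sqrt_nonneg _

theorem gSpeedOn_of_mem_nhds {s : Set ℝ} {α : ℝ → ℝ × ℝ} {t : ℝ} (hs : s ∈ 𝓝 t) :
    gSpeedOn s α t =
      Real.sqrt (deriv (fun u => (α u).1) t ^ 2 + deriv (fun u => (α u).2) t ^ 2) := by
  rw [gSpeedOn, derivWithin_of_mem_nhds hs, derivWithin_of_mem_nhds hs]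

theorem Fvol_nonneg {n : ℕ} {cn : ℝ} (hcn : 0 < cn) {z : ℝ × ℝ} (hz : z ∈ Pset) :
    0 ≤ Fvol n cn z :=
  mul_nonneg (mul_nonneg hcn.le (pow_nonneg hz.1 _)) (pow_nonneg hz.2 _)

theorem Fvol_pos {n : ℕ} {cn : ℝ} (hcn : 0 < cn) {z : ℝ × ℝ} (hz : z ∈ Pint) :
    0 < Fvol n cn z :=
  mul_pos (mul_pos hcn (pow_pos hz.1 _)) (pow_pos hz.2 _)

theorem continuous_Fvol (n : ℕ) (cn : ℝ) : Continuous (Fvol n cn) := by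
  unfold Fvol
  fun_prop

/-- `α` is a reparametrization of `β` by arc length, scaled to `[0,1]`, where `L` is the length
of `β` and `ρ` is its normalized speed. -/
structure IsArcReparam (β α : ℝ → ℝ × ℝ) (ρ : ℝ → ℝ) (L : ℝ) : Prop where
  density : UnitDensity ρ
  length_pos : 0 < L
  speed_eq : ∀ t ∈ Ioo (0:ℝ) 1, gSpeedOn (Ico 0 1) β t = L * ρ t
  comp_eq : ∀ t ∈ Icc (0:ℝ) 1, α (cumul ρ t) = β t
  lipschitz : ∃ K, LipschitzOnWith K α (Icc 0 1)

theorem ae_mem_Ioo_of_ne_zero {ρ : ℝ → ℝ} (h : UnitDensity ρ) :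
    ∀ᵐ t, ρ t ≠ 0 → t ∈ Ioo (0:ℝ) 1 := by
  filter_upwards [Measure.ae_ne volume (1:ℝ)] with t ht h0
  have : t ∈ Ioc (0:ℝ) 1 := by
    by_contra hc
    exact h0 (h.eq_zero t hc)
  exact ⟨this.1, this.2.lt_of_ne ht⟩

theorem ae_cumul_mem_Ioo {ρ : ℝ → ℝ} (h : UnitDensity ρ) :
    ∀ᵐ t, ρ t ≠ 0 → cumul ρ t ∈ Ioo (0:ℝ) 1 := by
  refine h.ae_comp_cumul ?_
  filter_upwards [Measure.ae_ne volume (0:ℝ), Measure.ae_ne volume (1:ℝ)] with s h0 h1 hs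
  exact ⟨hs.1.lt_of_ne' h0, hs.2.lt_of_ne h1⟩

theorem ae_differentiableAt_comp_cumul {ρ w : ℝ → ℝ} (h : UnitDensity ρ)
    (hw : ∃ K, LipschitzOnWith K w (Icc 0 1)) :
    ∀ᵐ t, ρ t ≠ 0 → DifferentiableAt ℝ w (cumul ρ t) := by
  obtain ⟨K, hK⟩ := hw
  filter_upwards [h.ae_comp_cumul hK.ae_differentiableWithinAt_of_mem, ae_cumul_mem_Ioo h]
    with t h1 h2 h0
  exact (h1 h0).differentiableAt (Icc_mem_nhds (h2 h0).1 (h2 h0).2)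

namespace IsArcReparam

variable {β α : ℝ → ℝ × ℝ} {ρ : ℝ → ℝ} {L : ℝ}

theorem lipschitz_fst (h : IsArcReparam β α ρ L) :
    ∃ K, LipschitzOnWith K (fun u => (α u).1) (Icc 0 1) := by
  obtain ⟨K, hK⟩ := h.lipschitz
  exact ⟨_, LipschitzWith.prod_fst.comp_lipschitzOnWith hK⟩

theorem lipschitz_snd (h : IsArcReparam β α ρ L) :
    ∃ K, LipschitzOnWith K (fun u => (α u).2) (Icc 0 1) := by
  obtain ⟨K, hK⟩ := h.lipschitz
  exact ⟨_, LipschitzWith.prod_snd.comp_lipschitzOnWith hK⟩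

theorem continuousOn (h : IsArcReparam β α ρ L) : ContinuousOn α (Icc 0 1) :=
  h.lipschitz.choose_spec.continuousOn

theorem ae_gSpeed_eq (h : IsArcReparam β α ρ L) :
    ∀ᵐ s, s ∈ Icc (0:ℝ) 1 → gSpeed α s = L := by
  have hρ := h.density
  have hmeas : MeasurableSet {s | Real.sqrt (deriv (fun u => (α u).1) s ^ 2 +
      deriv (fun u => (α u).2) s ^ 2) = L} := by
    refine measurableSet_eq_fun ?_ measurable_const
    exact (((measurable_deriv _).pow_const 2).add ((measurable_deriv _).pow_const 2)).sqrt
  have key := hρ.ae_of_ae_comp_cumul hmeas (by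
    filter_upwards [ae_mem_Ioo_of_ne_zero hρ, hρ.ae_hasDerivAt_cumul,
      ae_differentiableAt_comp_cumul hρ h.lipschitz_fst,
      ae_differentiableAt_comp_cumul hρ h.lipschitz_snd] with t ht hΛ h1 h2 h0
    have hIcc : ∀ᶠ u in 𝓝 t, u ∈ Icc (0:ℝ) 1 := Icc_mem_nhds (ht h0).1 (ht h0).2
    have e1 : (fun u => (β u).1) =ᶠ[𝓝 t] (fun u => (α u).1) ∘ cumul ρ := by
      filter_upwards [hIcc] with u hu
      simp [h.comp_eq u hu]
    have e2 : (fun u => (β u).2) =ᶠ[𝓝 t] (fun u => (α u).2) ∘ cumul ρ := by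
      filter_upwards [hIcc] with u hu
      simp [h.comp_eq u hu]
    have hs := h.speed_eq t (ht h0)
    rw [gSpeedOn_of_mem_nhds (Ico_mem_nhds (ht h0).1 (ht h0).2), e1.deriv_eq, e2.deriv_eq,
      ((h1 h0).hasDerivAt.comp t hΛ).deriv, ((h2 h0).hasDerivAt.comp t hΛ).deriv, mul_pow, mul_pow,
      ← add_mul, Real.sqrt_mul (by positivity), Real.sqrt_sq (hρ.nonneg t)] at hs
    exact mul_right_cancel₀ h0 hs)
  filter_upwards [key, Measure.ae_ne volume (0:ℝ), Measure.ae_ne volume (1:ℝ)] with s hs h0 h1 hmem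
  rw [gSpeed, gSpeedOn_of_mem_nhds (Icc_mem_nhds (hmem.1.lt_of_ne' h0) (hmem.2.lt_of_ne h1))]
  exact hs hmem

theorem Lg_eq (h : IsArcReparam β α ρ L) : Lg α = L := by
  rw [Lg, intervalIntegral.integral_congr_ae (g := fun _ => L)]
  · simp
  · filter_upwards [h.ae_gSpeed_eq] with s hs hs'
    rw [uIoc_of_le zero_le_one] at hs'
    exact hs ⟨hs'.1.le, hs'.2⟩

end IsArcReparam

theorem exists_isArcReparam {β : ℝ → ℝ × ℝ} (hc : ContinuousOn β (Icc 0 1))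
    (hlip : ∀ a ∈ Ico (0:ℝ) 1, ∃ K, LipschitzOnWith K β (Icc 0 a))
    {ρ : ℝ → ℝ} {L : ℝ} (hρ : UnitDensity ρ) (hL : 0 < L)
    (hspeed : ∀ t ∈ Ioo (0:ℝ) 1, gSpeedOn (Ico 0 1) β t = L * ρ t) :
    ∃ α, IsArcReparam β α ρ L := by
  have h1 : ∀ a ∈ Icc (0:ℝ) 1, ∀ b ∈ Icc (0:ℝ) 1, a ≤ b →
      |(β b).1 - (β a).1| ≤ L * (cumul ρ b - cumul ρ a) := by
    intro a ha b hb hab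
    rw [hρ.cumul_sub, ← intervalIntegral.integral_const_mul]
    refine abs_sub_le_integral_of_locally_lipschitz (f := fun t => (β t).1)
      hc.fst (fun a ha => ?_) (hρ.integrable.const_mul L) (fun t ht => ?_) ha.1 hab hb.2
    · obtain ⟨K, hK⟩ := hlip a ha
      exact ⟨_, LipschitzWith.prod_fst.comp_lipschitzOnWith hK⟩
    · rw [← hspeed t ht, gSpeedOn_of_mem_nhds (Ico_mem_nhds ht.1 ht.2)]
      exact Real.abs_le_sqrt (le_add_of_nonneg_right (sq_nonneg _))
  have h2 : ∀ a ∈ Icc (0:ℝ) 1, ∀ b ∈ Icc (0:ℝ) 1, a ≤ b →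
      |(β b).2 - (β a).2| ≤ L * (cumul ρ b - cumul ρ a) := by
    intro a ha b hb hab
    rw [hρ.cumul_sub, ← intervalIntegral.integral_const_mul]
    refine abs_sub_le_integral_of_locally_lipschitz (f := fun t => (β t).2)
      hc.snd (fun a ha => ?_) (hρ.integrable.const_mul L) (fun t ht => ?_) ha.1 hab hb.2
    · obtain ⟨K, hK⟩ := hlip a ha
      exact ⟨_, LipschitzWith.prod_snd.comp_lipschitzOnWith hK⟩
    · rw [← hspeed t ht, gSpeedOn_of_mem_nhds (Ico_mem_nhds ht.1 ht.2)]
      exact Real.abs_le_sqrt (le_add_of_nonneg_left (sq_nonneg _))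
  have hdist : ∀ a ∈ Icc (0:ℝ) 1, ∀ b ∈ Icc (0:ℝ) 1,
      dist (β a) (β b) ≤ L * dist (cumul ρ a) (cumul ρ b) := by
    intro a ha b hb
    wlog hab : a ≤ b generalizing a b
    · rw [dist_comm (β a), dist_comm (cumul ρ a)]
      exact this b hb a ha (le_of_not_ge hab)
    rw [dist_comm (β a), dist_comm (cumul ρ a), Real.dist_eq,
      abs_of_nonneg (sub_nonneg.2 (hρ.cumul_monotone hab)), Prod.dist_eq]
    exact max_le (h1 a ha b hb hab) (h2 a ha b hb hab)
  choose! τ hτ hτs using fun s (hs : s ∈ Icc (0:ℝ) 1) => hρ.exists_cumul_eq hs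
  refine ⟨fun s => β (τ s), hρ, hL, hspeed, fun t ht => ?_, L.toNNReal, ?_⟩
  · have hm := hρ.cumul_mem t
    have := hdist _ (hτ _ hm) t ht
    rw [hτs _ hm, dist_self, mul_zero] at this
    exact dist_le_zero.1 this
  · refine LipschitzOnWith.of_dist_le_mul fun s hs s' hs' => ?_
    have := hdist _ (hτ s hs) _ (hτ s' hs')
    rwa [hτs s hs, hτs s' hs', ← Real.coe_toNNReal L hL.le] at this

theorem lipschitz_comp_cumul_min {ρ w : ℝ → ℝ} (hρ : UnitDensity ρ)
    (hw : ∃ K, LipschitzOnWith K w (Icc 0 1)) {a C : ℝ} (hC : ∀ t ∈ Ioo 0 a, ρ t ≤ C) (ha : 0 < a) :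
    ∃ K, LipschitzOnWith K (fun t => w (cumul ρ (min t a))) (Icc 0 1) := by
  obtain ⟨K, hK⟩ := hw
  have hC0 : 0 ≤ C := (hρ.nonneg (a / 2)).trans (hC _ ⟨by linarith, by linarith⟩)
  have hΛ : LipschitzOnWith C.toNNReal (cumul ρ) (Icc 0 a) := by
    refine LipschitzOnWith.of_dist_le_mul fun s hs s' hs' => ?_
    wlog hss : s ≤ s' generalizing s s'
    · rw [dist_comm (cumul ρ s), dist_comm s]
      exact this s' hs' s hs (le_of_not_ge hss)
    rw [dist_comm (cumul ρ s), dist_comm s, Real.dist_eq, Real.dist_eq,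
      abs_of_nonneg (sub_nonneg.2 (hρ.cumul_monotone hss)), abs_of_nonneg (sub_nonneg.2 hss),
      hρ.cumul_sub, Real.coe_toNNReal C hC0]
    have := intervalIntegral.integral_mono_on_of_le_Ioo (μ := volume) (g := fun _ => C) hss
      hρ.integrable.intervalIntegrable intervalIntegrable_const
      fun t ht => hC t ⟨hs.1.trans_lt ht.1, ht.2.trans_le hs'.2⟩
    simpa [mul_comm] using this
  have hmin : LipschitzOnWith 1 (fun t : ℝ => min t a) (Icc 0 1) :=
    (LipschitzWith.id.min_const a).lipschitzOnWith
  exact ⟨_, hK.comp (hΛ.comp hmin fun t ht => ⟨le_min ht.1 ha.le, min_le_right _ _⟩)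
    fun t _ => hρ.cumul_mem _⟩

theorem lambdaGOn_le {n : ℕ} {cn p : ℝ} (hcn : 0 < cn) {s : Set ℝ} {β : ℝ → ℝ × ℝ}
    (hβ : ∀ t ∈ Icc (0:ℝ) 1, β t ∈ Pset) {w : ℝ → ℝ} (hw : ∃ K, LipschitzOnWith K w (Icc 0 1))
    (hw0 : w 0 = 0) (hnum : IntervalIntegrable (numG n cn p s β w) volume 0 1)
    (hden : IntervalIntegrable (denG n cn p s β w) volume 0 1)
    (hpos : 0 < ∫ t in (0:ℝ)..1, denG n cn p s β w t) :
    lambdaGOn n cn p s β ≤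
      (∫ t in (0:ℝ)..1, numG n cn p s β w t) / ∫ t in (0:ℝ)..1, denG n cn p s β w t := by
  refine csInf_le ⟨0, ?_⟩ ⟨w, hw, hw0, hnum, hden, hpos, rfl⟩
  rintro q ⟨v, -, -, -, -, hv, rfl⟩
  refine div_nonneg (intervalIntegral.integral_nonneg zero_le_one fun t ht => ?_) hv.le
  exact mul_nonneg (mul_nonneg (by positivity) (Fvol_nonneg hcn (hβ t ht)))
    (Real.rpow_nonneg (gSpeedOn_nonneg _ _ _) _)

namespace IsArcReparam

variable {β α : ℝ → ℝ × ℝ} {ρ : ℝ → ℝ} {L : ℝ}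

theorem ae_numG_eq (h : IsArcReparam β α ρ L) (n : ℕ) (cn : ℝ) {p : ℝ} (hp : 2 ≤ p) {w : ℝ → ℝ}
    (hw : ∃ K, LipschitzOnWith K w (Icc 0 1)) {a : ℝ} :
    ∀ᵐ t, t ∈ Ioc (0:ℝ) 1 →
      numG n cn p (Ico 0 1) β (fun t => w (cumul ρ (min t a))) t =
        (Iic a).indicator (fun t => ρ t * numG n cn p (Icc 0 1) α w (cumul ρ t)) t := by
  have hρ := h.density
  have hp0 : p ≠ 0 := by linarith
  filter_upwards [Measure.ae_ne volume (1:ℝ), Measure.ae_ne volume a, hρ.ae_hasDerivAt_cumul,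
    ae_differentiableAt_comp_cumul hρ hw, ae_cumul_mem_Ioo hρ, hρ.ae_comp_cumul h.ae_gSpeed_eq]
    with t ht1 hta hΛ hd hmem hs htm
  have ht : t ∈ Ioo (0:ℝ) 1 := ⟨htm.1, htm.2.lt_of_ne ht1⟩
  have hnhds := Icc_mem_nhds ht.1 ht.2
  rcases lt_or_gt_of_ne hta with hlt | hgt
  · rw [indicator_of_mem (show t ∈ Iic a from hlt.le)]
    rcases eq_or_ne (ρ t) 0 with h0 | h0
    · rw [numG, h.speed_eq t ht, h0, mul_zero, zero_mul,
        Real.zero_rpow (by linarith), mul_zero]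
    · have e : (fun t => w (cumul ρ (min t a))) =ᶠ[𝓝 t] w ∘ cumul ρ := by
        filter_upwards [Iio_mem_nhds hlt] with u hu
        simp [min_eq_left (mem_Iio.1 hu).le]
      have hspeed : gSpeedOn (Icc 0 1) α (cumul ρ t) = L := hs h0
      have hρt : 0 < ρ t := (hρ.nonneg t).lt_of_ne' h0
      have hpow : ρ t ^ p * ρ t ^ (1 - p) = ρ t := by
        rw [← Real.rpow_add hρt, add_sub_cancel, Real.rpow_one]
      rw [numG, numG, hspeed, h.speed_eq t ht, derivWithin_of_mem_nhds hnhds, e.deriv_eq,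
        ((hd h0).hasDerivAt.comp t hΛ).deriv,
        derivWithin_of_mem_nhds (Icc_mem_nhds (hmem h0).1 (hmem h0).2),
        h.comp_eq t ⟨ht.1.le, ht.2.le⟩, abs_mul, abs_of_pos hρt,
        Real.mul_rpow (abs_nonneg _) hρt.le, Real.mul_rpow h.length_pos.le hρt.le]
      linear_combination (|deriv w (cumul ρ t)| ^ p * Fvol n cn (β t) * L ^ (1 - p)) * hpow
  · rw [indicator_of_notMem (show t ∉ Iic a from not_le.2 hgt)]
    have e : (fun t => w (cumul ρ (min t a))) =ᶠ[𝓝 t] fun _ => w (cumul ρ a) := by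
      filter_upwards [Ioi_mem_nhds hgt] with u hu
      simp [min_eq_right (mem_Ioi.1 hu).le]
    rw [numG, derivWithin_of_mem_nhds hnhds, e.deriv_eq, deriv_const, abs_zero,
      Real.zero_rpow hp0, zero_mul, zero_mul]

theorem ae_denG_eq (h : IsArcReparam β α ρ L) (n : ℕ) (cn p : ℝ) (v : ℝ → ℝ) :
    ∀ᵐ t, t ∈ Ioc (0:ℝ) 1 →
      denG n cn p (Ico 0 1) β v t = |v t| ^ p * Fvol n cn (β t) * (L * ρ t) := by
  filter_upwards [Measure.ae_ne volume (1:ℝ)] with t ht1 ht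
  rw [denG, h.speed_eq t ⟨ht.1, ht.2.lt_of_ne ht1⟩]

theorem ae_denG_comp_eq (h : IsArcReparam β α ρ L) (n : ℕ) (cn p : ℝ) (w : ℝ → ℝ) :
    ∀ᵐ t, t ∈ Ioc (0:ℝ) 1 → ρ t * denG n cn p (Icc 0 1) α w (cumul ρ t) =
      |w (cumul ρ t)| ^ p * Fvol n cn (β t) * (L * ρ t) := by
  filter_upwards [h.density.ae_comp_cumul h.ae_gSpeed_eq] with t hs ht
  rcases eq_or_ne (ρ t) 0 with h0 | h0
  · simp [h0]
  · have hspeed : gSpeedOn (Icc 0 1) α (cumul ρ t) = L := hs h0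
    rw [denG, hspeed, h.comp_eq t ⟨ht.1.le, ht.2⟩]
    ring

theorem mem_Pset (h : IsArcReparam β α ρ L) (hβ : ∀ t ∈ Icc (0:ℝ) 1, β t ∈ Pset) {s : ℝ}
    (hs : s ∈ Icc (0:ℝ) 1) : α s ∈ Pset := by
  obtain ⟨t, ht, rfl⟩ := h.density.exists_cumul_eq hs
  rw [h.comp_eq t ht]
  exact hβ t ht

theorem numG_comp_nonneg (h : IsArcReparam β α ρ L) {n : ℕ} {cn : ℝ} (hcn : 0 < cn) (p : ℝ)
    (hβ : ∀ t ∈ Icc (0:ℝ) 1, β t ∈ Pset) (w : ℝ → ℝ) (t : ℝ) :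
    0 ≤ ρ t * numG n cn p (Icc 0 1) α w (cumul ρ t) :=
  mul_nonneg (h.density.nonneg t) (mul_nonneg (mul_nonneg (by positivity)
    (Fvol_nonneg hcn (h.mem_Pset hβ (h.density.cumul_mem t))))
    (Real.rpow_nonneg (gSpeedOn_nonneg _ _ _) _))

/-- The denominators of the Rayleigh quotients of the truncated test functions are integrable and
converge to the denominator for the reparametrized curve. -/
theorem denG_truncated (h : IsArcReparam β α ρ L) (n : ℕ) (cn : ℝ) {p : ℝ} (hp : 2 ≤ p)
    (hc : ContinuousOn β (Icc 0 1)) {w : ℝ → ℝ} (hw : ∃ K, LipschitzOnWith K w (Icc 0 1))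
    (hden : IntervalIntegrable (denG n cn p (Icc 0 1) α w) volume 0 1) :
    (∀ a, IntervalIntegrable
      (denG n cn p (Ico 0 1) β (fun t => w (cumul ρ (min t a)))) volume 0 1) ∧
    Tendsto (fun a => ∫ t in (0:ℝ)..1,
      denG n cn p (Ico 0 1) β (fun t => w (cumul ρ (min t a))) t) (𝓝[<] 1)
      (𝓝 (∫ s in (0:ℝ)..1, denG n cn p (Icc 0 1) α w s)) := by
  have hρ := h.density
  have hwc : ContinuousOn w (Icc 0 1) := hw.choose_spec.continuousOn
  obtain ⟨W, hW⟩ := isCompact_Icc.exists_bound_of_continuousOn hwc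
  have hFc : ContinuousOn (fun t => Fvol n cn (β t)) (Icc 0 1) :=
    (continuous_Fvol n cn).comp_continuousOn hc
  obtain ⟨B, hB⟩ := isCompact_Icc.exists_bound_of_continuousOn hFc
  have hcont : ∀ a, ContinuousOn
      (fun t => |w (cumul ρ (min t a))| ^ p * Fvol n cn (β t)) (Icc 0 1) := by
    intro a
    refine ContinuousOn.mul (ContinuousOn.rpow_const ?_ fun _ _ => Or.inr (by linarith)) hFc
    exact (hwc.comp_continuous (hρ.cumul_continuous.comp (continuous_id.min continuous_const))
      fun t => hρ.cumul_mem _).abs.continuousOn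
  have hint : ∀ a, IntervalIntegrable
      (fun t => |w (cumul ρ (min t a))| ^ p * Fvol n cn (β t) * (L * ρ t)) volume 0 1 := by
    intro a
    refine IntervalIntegrable.continuousOn_mul
      (hρ.integrable.const_mul L).intervalIntegrable ?_
    rw [uIcc_of_le zero_le_one]
    exact hcont a
  have hae : ∀ a, ∀ᵐ t, t ∈ uIoc (0:ℝ) 1 →
      denG n cn p (Ico 0 1) β (fun t => w (cumul ρ (min t a))) t =
        |w (cumul ρ (min t a))| ^ p * Fvol n cn (β t) * (L * ρ t) := by
    intro a
    rw [uIoc_of_le zero_le_one]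
    exact h.ae_denG_eq n cn p _
  refine ⟨fun a => (hint a).congr_ae ?_, ?_⟩
  · rw [EventuallyEq, ae_restrict_iff' measurableSet_uIoc]
    filter_upwards [hae a] with t ht htm
    exact (ht htm).symm
  · simp_rw [fun a => intervalIntegral.integral_congr_ae (hae a)]
    rw [← hρ.integral_comp_cumul hden, intervalIntegral.integral_congr_ae
      (g := fun t => |w (cumul ρ t)| ^ p * Fvol n cn (β t) * (L * ρ t))
      (by rw [uIoc_of_le zero_le_one]; exact h.ae_denG_comp_eq n cn p w)]
    refine intervalIntegral.tendsto_integral_filter_of_dominated_convergence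
      (fun t => W ^ p * B * (L * ρ t)) (Eventually.of_forall fun a => (hint a).def'.1)
      (Eventually.of_forall fun a => ae_of_all _ fun t ht => ?_)
      ((hρ.integrable.const_mul L).const_mul _).intervalIntegrable ?_
    · rw [uIoc_of_le zero_le_one] at ht
      have hρt := hρ.nonneg t
      have hL := h.length_pos
      rw [norm_mul, norm_mul, Real.norm_of_nonneg (by positivity : 0 ≤ L * ρ t),
        Real.norm_of_nonneg (Real.rpow_nonneg (abs_nonneg _) _)]
      have h1 : |w (cumul ρ (min t a))| ^ p ≤ W ^ p :=
        Real.rpow_le_rpow (abs_nonneg _) (hW _ (hρ.cumul_mem _)) (by linarith)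
      have h2 := hB t ⟨ht.1.le, ht.2⟩
      have h3 : 0 ≤ W ^ p := (Real.rpow_nonneg (abs_nonneg _) _).trans h1
      gcongr
    · filter_upwards [Measure.ae_ne volume (1:ℝ)] with t ht1 ht
      rw [uIoc_of_le zero_le_one] at ht
      refine tendsto_const_nhds.congr' ?_
      filter_upwards [Ioo_mem_nhdsLT (ht.2.lt_of_ne ht1)] with a ha
      rw [min_eq_left ha.1.le]

theorem lambdaGOn_le_rayleigh (h : IsArcReparam β α ρ L) {n : ℕ} {cn p : ℝ} (hcn : 0 < cn)
    (hp : 2 ≤ p) (hc : ContinuousOn β (Icc 0 1)) (hβ : ∀ t ∈ Icc (0:ℝ) 1, β t ∈ Pset)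
    (hbdd : ∀ a ∈ Ioo (0:ℝ) 1, ∃ C, ∀ t ∈ Ioo 0 a, ρ t ≤ C)
    {w : ℝ → ℝ} (hw : ∃ K, LipschitzOnWith K w (Icc 0 1)) (hw0 : w 0 = 0)
    (hnum : IntervalIntegrable (numG n cn p (Icc 0 1) α w) volume 0 1)
    (hden : IntervalIntegrable (denG n cn p (Icc 0 1) α w) volume 0 1)
    (hpos : 0 < ∫ t in (0:ℝ)..1, denG n cn p (Icc 0 1) α w t) :
    lambdaGOn n cn p (Ico 0 1) β ≤ (∫ t in (0:ℝ)..1, numG n cn p (Icc 0 1) α w t) /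
      ∫ t in (0:ℝ)..1, denG n cn p (Icc 0 1) α w t := by
  have hρ := h.density
  obtain ⟨hint, hlim⟩ := h.denG_truncated n cn hp hc hw hden
  refine ge_of_tendsto (tendsto_const_nhds.div hlim hpos.ne') ?_
  filter_upwards [hlim.eventually_const_lt hpos, Ioo_mem_nhdsLT (zero_lt_one' ℝ)] with a hDa ha
  obtain ⟨C, hC⟩ := hbdd a ha
  have hI := hρ.integrable_comp_cumul hnum
  have hIa := hI.indicator (measurableSet_Iic (a := a))
  have hae := h.ae_numG_eq n cn hp hw (a := a)
  have hNa : IntervalIntegrable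
      (numG n cn p (Ico 0 1) β (fun t => w (cumul ρ (min t a)))) volume 0 1 := by
    refine hIa.intervalIntegrable.congr_ae ?_
    rw [EventuallyEq, ae_restrict_iff' measurableSet_uIoc, uIoc_of_le zero_le_one]
    filter_upwards [hae] with t ht htm
    exact (ht htm).symm
  refine (lambdaGOn_le hcn hβ (lipschitz_comp_cumul_min hρ hw hC ha.1)
    (by simp [min_eq_left ha.1.le, UnitDensity.cumul_zero, hw0]) hNa (hint a) hDa).trans ?_
  refine div_le_div_of_nonneg_right ?_ hDa.le
  rw [← hρ.integral_comp_cumul hnum,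
    intervalIntegral.integral_congr_ae (by rw [uIoc_of_le zero_le_one]; exact hae)]
  exact intervalIntegral.integral_mono_on zero_le_one hIa.intervalIntegrable hI.intervalIntegrable
    fun t _ => indicator_le_self' (fun t _ => h.numG_comp_nonneg hcn p hβ w t) t

theorem lambdaGOn_le_lambdaG (h : IsArcReparam β α ρ L) {n : ℕ} {cn p : ℝ} (hcn : 0 < cn)
    (hp : 2 ≤ p) (hc : ContinuousOn β (Icc 0 1)) (hβ : ∀ t ∈ Icc (0:ℝ) 1, β t ∈ Pset)
    (hbdd : ∀ a ∈ Ioo (0:ℝ) 1, ∃ C, ∀ t ∈ Ioo 0 a, ρ t ≤ C)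
    (hα : ∀ s ∈ Ico (0:ℝ) 1, α s ∈ Pint) :
    lambdaGOn n cn p (Ico 0 1) β ≤ lambdaG n cn p α := by
  refine le_csInf ?_ ?_
  · have hFc : ContinuousOn (fun t => Fvol n cn (α t)) (Icc 0 1) :=
      (continuous_Fvol n cn).comp_continuousOn h.continuousOn
    have hF : IntervalIntegrable (fun s => Fvol n cn (α s) * L ^ (1 - p)) volume 0 1 := by
      refine ContinuousOn.intervalIntegrable ?_
      rw [uIcc_of_le zero_le_one]
      exact hFc.mul continuousOn_const
    have hD : IntervalIntegrable (fun s => |s| ^ p * Fvol n cn (α s) * L) volume 0 1 := by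
      refine ContinuousOn.intervalIntegrable ?_
      rw [uIcc_of_le zero_le_one]
      exact (((continuous_abs.rpow_const fun _ => Or.inr (by linarith)).continuousOn).mul hFc).mul
        continuousOn_const
    have hDae : ∀ᵐ s, s ∈ uIoc (0:ℝ) 1 →
        |s| ^ p * Fvol n cn (α s) * L = denG n cn p (Icc 0 1) α id s := by
      rw [uIoc_of_le zero_le_one]
      filter_upwards [h.ae_gSpeed_eq] with s hs hsm
      have hspeed : gSpeedOn (Icc 0 1) α s = L := hs ⟨hsm.1.le, hsm.2⟩
      rw [denG, hspeed, id]
    refine ⟨_, id, ⟨1, LipschitzWith.id.lipschitzOnWith⟩, rfl, hF.congr_ae ?_, hD.congr_ae ?_,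
      ?_, rfl⟩
    · rw [EventuallyEq, ae_restrict_iff' measurableSet_uIoc, uIoc_of_le zero_le_one]
      filter_upwards [h.ae_gSpeed_eq] with s hs hsm
      have hsm' : s ∈ Icc (0:ℝ) 1 := ⟨hsm.1.le, hsm.2⟩
      have hspeed : gSpeedOn (Icc 0 1) α s = L := hs hsm'
      rw [numG, hspeed, derivWithin_id _ _ (uniqueDiffOn_Icc_zero_one s hsm'), abs_one,
        Real.one_rpow, one_mul]
    · rw [EventuallyEq, ae_restrict_iff' measurableSet_uIoc]
      exact hDae
    · rw [← intervalIntegral.integral_congr_ae hDae]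
      refine intervalIntegral.intervalIntegral_pos_of_pos_on hD (fun s hs => ?_) zero_lt_one
      have := Fvol_pos (n := n) hcn (hα s ⟨hs.1.le, hs.2⟩)
      have := h.length_pos
      have := hs.1
      positivity
  · rintro q ⟨w, hw, hw0, hnum, hden, hpos, rfl⟩
    exact h.lambdaGOn_le_rayleigh hcn hp hc hβ hbdd hw hw0 hnum hden hpos

end IsArcReparam

/-- Reparametrization by Euclidean arc length: a curve
`β ∈ R_h^+` with finite positive Euclidean length can be reparametrized to a
constant-speed curve `α ∈ R_g` with `α(ℓ_g(t)) = β(t)` and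
`λ_{1,p}(α) ≥ λ_{1,p}(β)` for all `p ≥ 2`. -/
theorem simons_stmt10 (n : ℕ) (hn : 2 ≤ n) (cn : ℝ) (hcn : 0 < cn)
    (x0 y0 : ℝ) (hy0 : 0 < y0) (hxy : y0 ≤ x0)
    (β : ℝ → ℝ × ℝ) (hβ : MemRhPlus n cn x0 y0 β)
    (hfin : IntervalIntegrable (gSpeedOn (Ico 0 1) β) volume 0 1)
    (hpos : 0 < ∫ t in (0:ℝ)..1, gSpeedOn (Ico 0 1) β t) :
    ∃ α : ℝ → ℝ × ℝ, MemRg x0 y0 α ∧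
      (∀ t ∈ Icc (0:ℝ) 1,
        α ((∫ u in (0:ℝ)..t, gSpeedOn (Ico 0 1) β u) /
            (∫ u in (0:ℝ)..1, gSpeedOn (Ico 0 1) β u)) = β t) ∧
      (∀ᵐ t ∂(volume : Measure ℝ), t ∈ Icc (0:ℝ) 1 → gSpeed α t = Lg α) ∧
      ∀ p : ℝ, 2 ≤ p → lambdaGOn n cn p (Ico 0 1) β ≤ lambdaG n cn p α := by
  obtain ⟨hc, hP, hbd, h0, hint, hlip, -, -⟩ := hβ
  set L := ∫ t in (0:ℝ)..1, gSpeedOn (Ico 0 1) β t with hL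
  set ρ : ℝ → ℝ := (Ioc (0:ℝ) 1).indicator fun t => gSpeedOn (Ico 0 1) β t / L with hρdef
  have hcumul : ∀ t ∈ Icc (0:ℝ) 1,
      cumul ρ t = (∫ u in (0:ℝ)..t, gSpeedOn (Ico 0 1) β u) / L := by
    intro t ht
    rw [cumul, ← intervalIntegral.integral_div]
    refine intervalIntegral.integral_congr_ae (ae_of_all _ fun u hu => ?_)
    rw [uIoc_of_le ht.1] at hu
    exact indicator_of_mem (show u ∈ Ioc (0:ℝ) 1 from ⟨hu.1, hu.2.trans ht.2⟩) _
  have hρ : UnitDensity ρ :=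
    { integrable := (integrable_indicator_iff measurableSet_Ioc).2
        (((intervalIntegrable_iff_integrableOn_Ioc_of_le zero_le_one).1 hfin).div_const L)
      nonneg := indicator_nonneg fun t _ => div_nonneg (gSpeedOn_nonneg _ _ _) hpos.le
      eq_zero := fun t ht => indicator_of_notMem ht _
      total := (hcumul 1 ⟨zero_le_one, le_rfl⟩).trans (div_self hpos.ne') }
  have hspeed : ∀ t ∈ Ioo (0:ℝ) 1, gSpeedOn (Ico 0 1) β t = L * ρ t := by
    intro t ht
    rw [hρdef, indicator_of_mem (show t ∈ Ioc (0:ℝ) 1 from ⟨ht.1, ht.2.le⟩),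
      mul_div_cancel₀ _ hpos.ne']
  obtain ⟨α, hα⟩ := exists_isArcReparam hc hlip hρ hpos hspeed
  have hend : α 1 = β 1 := by
    simpa [hρ.cumul_one] using hα.comp_eq 1 ⟨zero_le_one, le_rfl⟩
  have hint' : ∀ s ∈ Ico (0:ℝ) 1, α s ∈ Pint := by
    intro s hs
    obtain ⟨t, ht, rfl⟩ := hρ.exists_cumul_eq ⟨hs.1, hs.2.le⟩
    rw [hα.comp_eq t ht]
    refine hint t ⟨ht.1, ht.2.lt_of_ne ?_⟩
    rintro rfl
    exact hs.2.ne hρ.cumul_one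
  refine ⟨α, ⟨hα.lipschitz, ?_, hend ▸ hbd, hint'⟩, fun t ht => ?_, ?_, fun p hp => ?_⟩
  · rw [← h0, ← hα.comp_eq 0 ⟨le_rfl, zero_le_one⟩, UnitDensity.cumul_zero]
  · rw [← hcumul t ht, hα.comp_eq t ht]
  · rw [hα.Lg_eq]
    exact hα.ae_gSpeed_eq
  · refine hα.lambdaGOn_le_lambdaG hcn hp hc hP (fun a ha => ?_) hint'
    obtain ⟨K, hK⟩ := hlip a ⟨ha.1.le, ha.2⟩
    refine ⟨Real.sqrt ((K:ℝ) ^ 2 + (K:ℝ) ^ 2) / L, fun t ht => ?_⟩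
    have ht1 : t ∈ Ioo (0:ℝ) 1 := ⟨ht.1, ht.2.trans ha.2⟩
    have hn := Icc_mem_nhds ht.1 ht.2
    rw [le_div_iff₀ hpos, mul_comm, ← hspeed t ht1,
      gSpeedOn_of_mem_nhds (Ico_mem_nhds ht1.1 ht1.2)]
    have d1 := norm_deriv_le_of_lipschitzOn hn (LipschitzWith.prod_fst.comp_lipschitzOnWith hK)
    have d2 := norm_deriv_le_of_lipschitzOn hn (LipschitzWith.prod_snd.comp_lipschitzOnWith hK)
    rw [one_mul] at d1 d2
    exact Real.sqrt_le_sqrt (add_le_add (sq_le_sq' (neg_le_of_abs_le d1) (le_of_abs_le d1))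
      (sq_le_sq' (neg_le_of_abs_le d2) (le_of_abs_le d2)))
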